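/- arXiv:2207.09997 — 4 statements merged into one kernel-verified Lean document; each statement's English description precedes it below -/
import Mathlib

section
/- Let λ ∈ ℝ, let m, r be integers with m ≥ r ≥ 0, and let f ∈ ℝ[[x]] be a formal power series. Then (xD)_{m−r,λ}(x^r · D^r f) = Σ_{l=r}^{m} {(m−r)+r \brace (l−r)+r}_{r,λ} · x^l · D^l f. -/
open Finset PowerSeries

/-- Degenerate falling factorial `(x)_{n,λ} = x(x-λ)⋯(x-(n-1)λ)`. -/
noncomputable def dfall (lam x : ℝ) (n : ℕ) : ℝ := ∏ i ∈ Finset.range n, (x - i * lam)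

/-- Ordinary falling factorial `(x)_n = x(x-1)⋯(x-n+1)`. -/
noncomputable def ffall (x : ℝ) (n : ℕ) : ℝ := ∏ i ∈ Finset.range n, (x - i)

/-- Degenerate rising factorial `⟨x⟩_{n,λ} = x(x+λ)⋯(x+(n-1)λ)`. -/
noncomputable def drise (lam x : ℝ) (n : ℕ) : ℝ := ∏ i ∈ Finset.range n, (x + i * lam)

/-- Rising factorial `⟨x⟩_n = x(x+1)⋯(x+n-1)`. -/
noncomputable def rise (x : ℝ) (n : ℕ) : ℝ := ∏ i ∈ Finset.range n, (x + i)

/-- Formal derivative `D = d/dx` on `ℝ⟦X⟧`. -/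
noncomputable def D (f : PowerSeries ℝ) : PowerSeries ℝ := PowerSeries.derivativeFun f

/-- The operator `(xD + c)_{m,λ} = (xD+c)(xD+c-λ)⋯(xD+c-(m-1)λ)` applied to a power series,
where the factor with the largest shift is applied first. -/
noncomputable def xDFall (lam c : ℝ) : ℕ → PowerSeries ℝ → PowerSeries ℝ
  | 0, f => f
  | m + 1, f => xDFall lam c m (PowerSeries.X * D f + (c - m * lam) • f)

theorem coeff_D (f : PowerSeries ℝ) (n : ℕ) :
    coeff n (D f) = coeff (n + 1) f * (n + 1) :=
  PowerSeries.coeff_derivative f n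

theorem coeff_X_pow_succ_mul_D (g : PowerSeries ℝ) (l n : ℕ) :
    coeff n (PowerSeries.X ^ (l + 1) * D g)
      = ((n : ℝ) - l) * coeff n (PowerSeries.X ^ l * g) := by
  rw [PowerSeries.coeff_X_pow_mul', PowerSeries.coeff_X_pow_mul']
  rcases lt_trichotomy n l with h | rfl | h
  · simp [show ¬ l + 1 ≤ n by omega, show ¬ l ≤ n by omega]
  · simp
  · obtain ⟨k, rfl⟩ := Nat.exists_eq_add_of_le (Nat.succ_le_of_lt h)
    rw [if_pos (by omega), if_pos (by omega), coeff_D,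
      show l.succ + k - (l + 1) = k by omega, show l.succ + k - l = k + 1 by omega]
    push_cast
    ring

theorem coeff_X_pow_mul_iterate_D (f : PowerSeries ℝ) (l n : ℕ) :
    coeff n (PowerSeries.X ^ l * D^[l] f) = ffall n l * coeff n f := by
  induction l with
  | zero => simp [ffall]
  | succ l ih =>
    rw [Function.iterate_succ_apply', coeff_X_pow_succ_mul_D, ih, ffall, ffall,
      Finset.prod_range_succ]
    ring

theorem coeff_xDFall (lam c : ℝ) (m n : ℕ) (f : PowerSeries ℝ) :
    coeff n (xDFall lam c m f) = dfall lam (n + c) m * coeff n f := by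
  induction m generalizing f with
  | zero => simp [xDFall, dfall]
  | succ m ih =>
    have h : coeff n (PowerSeries.X * D f) = n * coeff n f := by
      simpa using coeff_X_pow_succ_mul_D f 0 n
    rw [xDFall, ih, map_add, h, PowerSeries.coeff_smul, dfall, dfall,
      Finset.prod_range_succ, smul_eq_mul]
    ring

theorem ffall_add (x : ℝ) (r k : ℕ) : ffall x (r + k) = ffall x r * ffall (x - r) k := by
  simp only [ffall, Finset.prod_range_add, Nat.cast_add, sub_sub]

/-- for `m ≥ r ≥ 0`,
`(xD)_{m−r,λ}(x^r · D^r f) = Σ_{l=r}^{m} {(m−r)+r \brace (l−r)+r}_{r,λ} x^l D^l f`. -/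
theorem statement1 (lam : ℝ) (m r : ℕ) (hmr : r ≤ m) (S : ℕ → ℤ → ℝ)
    (hS : ∀ (n : ℕ) (x : ℝ),
      dfall lam (x + r) n = ∑ k ∈ Finset.range (n + 1), S n k * ffall x k)
    (hS0 : ∀ (n : ℕ) (k : ℤ), k < 0 ∨ (n : ℤ) < k → S n k = 0)
    (f : PowerSeries ℝ) :
    xDFall lam 0 (m - r) (PowerSeries.X ^ r * D^[r] f)
      = ∑ l ∈ Finset.Icc r m, S (m - r) ((l : ℤ) - r) • (PowerSeries.X ^ l * D^[l] f) := by
  ext n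
  rw [coeff_xDFall, coeff_X_pow_mul_iterate_D, map_sum]
  simp only [PowerSeries.coeff_smul, coeff_X_pow_mul_iterate_D, smul_eq_mul]
  rw [← Finset.Ico_add_one_right_eq_Icc, Finset.sum_Ico_eq_sum_range,
    show m + 1 - r = m - r + 1 by omega,
    show (n : ℝ) + 0 = ((n : ℝ) - r) + r by ring, hS, Finset.sum_mul]
  refine Finset.sum_congr rfl fun k _ => ?_
  rw [ffall_add, Nat.cast_add, add_sub_cancel_left]
  ring
end

section
/- Let A be an associative unital ℝ-algebra containing elements a and a⁺ with a·a⁺ − a⁺·a = 1, let λ ∈ ℝ, and let m, r be integers with m ≥ r ≥ 0. Then (a⁺a)_{m−r,λ} (a⁺)^r a^r = Σ_{l=r}^{m} {(m−r)+r \brace (l−r)+r}_{r,λ} · (a⁺)^l a^l in A. -/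
open Finset

/-- Degenerate falling factorial of an algebra element:
`(u)_{m,λ} = ∏_{i=0}^{m-1} (u - iλ·1)`, multiplied in increasing order of `i`. -/
noncomputable def algFall {A : Type*} [Ring A] [Algebra ℝ A] (lam : ℝ) (u : A) (m : ℕ) : A :=
  ((List.range m).map (fun i => u - ((i : ℝ) * lam) • (1 : A))).prod

theorem dfall_eq_eval (lam x c : ℝ) (n : ℕ) :
    dfall lam (x + c) n =
      (∏ i ∈ range n, (Polynomial.X + Polynomial.C (c - i * lam))).eval x := by
  simp only [dfall, Polynomial.eval_prod, Polynomial.eval_add, Polynomial.eval_X,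
    Polynomial.eval_C, add_sub_assoc]

theorem ffall_eq_eval (x : ℝ) (n : ℕ) : ffall x n = (descPochhammer ℝ n).eval x :=
  (descPochhammer_eval_eq_prod_range n x).symm

section

variable {A : Type*} [Ring A] [Algebra ℝ A]

theorem algFall_succ (lam : ℝ) (u : A) (n : ℕ) :
    algFall lam u (n + 1) = algFall lam u n * (u - ((n : ℝ) * lam) • (1 : A)) := by
  simp [algFall, List.range_succ]

theorem algFall_add_natCast (lam : ℝ) (u : A) (r n : ℕ) :
    algFall lam (u + (r : A)) n =
      Polynomial.aeval u
        (∏ i ∈ range n, (Polynomial.X + Polynomial.C ((r : ℝ) - i * lam))) := by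
  induction n with
  | zero => simp [algFall]
  | succ n ih =>
    rw [algFall_succ, ih, prod_range_succ, map_mul]
    congr 1
    rw [map_add, Polynomial.aeval_X, Polynomial.aeval_C, map_sub, map_natCast,
      Algebra.algebraMap_eq_smul_one, add_sub_assoc]

theorem SemiconjBy.algFall {x u v : A} (h : SemiconjBy x u v) (lam : ℝ) (n : ℕ) :
    SemiconjBy x (algFall lam u n) (algFall lam v n) := by
  induction n with
  | zero => simp [_root_.algFall]
  | succ n ih =>
    rw [algFall_succ, algFall_succ]
    refine ih.mul_right (h.sub_right ?_)
    rw [SemiconjBy, mul_smul_comm, smul_mul_assoc, mul_one, one_mul]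

end

section

variable {A : Type*} [Ring A] {a ad : A}

theorem semiconjBy_raising_pow (hcomm : a * ad - ad * a = 1) (r : ℕ) :
    SemiconjBy (ad ^ r) (ad * a + (r : A)) (ad * a) := by
  induction r with
  | zero => simp
  | succ r ih =>
    have h : SemiconjBy ad (ad * a + ((r + 1 : ℕ) : A)) (ad * a + (r : A)) := by
      rw [SemiconjBy, add_mul, mul_assoc ad a ad, sub_eq_iff_eq_add.mp hcomm, Nat.cast_comm r ad]
      push_cast
      noncomm_ring
    rw [pow_succ]
    exact ih.mul_left h

theorem semiconjBy_lowering_pow (hcomm : a * ad - ad * a = 1) (k : ℕ) :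
    SemiconjBy (a ^ k) (ad * a) (ad * a + (k : A)) := by
  induction k with
  | zero => simp
  | succ k ih =>
    have h : SemiconjBy a (ad * a + (k : A)) (ad * a + ((k + 1 : ℕ) : A)) := by
      rw [SemiconjBy, mul_add, ← mul_assoc a ad a, sub_eq_iff_eq_add.mp hcomm, ← Nat.cast_comm k a]
      push_cast
      noncomm_ring
    rw [pow_succ']
    exact h.mul_left ih

theorem aeval_descPochhammer_number [Algebra ℝ A] (hcomm : a * ad - ad * a = 1) (k : ℕ) :
    Polynomial.aeval (ad * a) (descPochhammer ℝ k) = ad ^ k * a ^ k := by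
  induction k with
  | zero => simp
  | succ k ih =>
    rw [descPochhammer_succ_right, map_mul, ih, map_sub, Polynomial.aeval_X, map_natCast,
      mul_assoc, mul_sub, (semiconjBy_lowering_pow hcomm k).eq, ← Nat.cast_comm k (a ^ k),
      add_mul, add_sub_cancel_right, pow_succ ad, pow_succ' a]
    simp only [mul_assoc]

end

/-- for `m ≥ r ≥ 0`,
`(a⁺a)_{m−r,λ}(a⁺)^r a^r = Σ_{l=r}^{m} {(m−r)+r \brace (l−r)+r}_{r,λ} (a⁺)^l a^l`. -/
theorem statement3 {A : Type*} [Ring A] [Algebra ℝ A] (a ad : A)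
    (hcomm : a * ad - ad * a = 1) (lam : ℝ) (m r : ℕ) (hmr : r ≤ m) (S : ℕ → ℤ → ℝ)
    (hS : ∀ (n : ℕ) (x : ℝ),
      dfall lam (x + r) n = ∑ k ∈ Finset.range (n + 1), S n k * ffall x k)
    (hS0 : ∀ (n : ℕ) (k : ℤ), k < 0 ∨ (n : ℤ) < k → S n k = 0) :
    algFall lam (ad * a) (m - r) * ad ^ r * a ^ r
      = ∑ l ∈ Finset.Icc r m, S (m - r) ((l : ℤ) - r) • (ad ^ l * a ^ l) := by
  obtain ⟨n, rfl⟩ := Nat.exists_eq_add_of_le hmr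
  have hpoly : ∏ i ∈ range n, (Polynomial.X + Polynomial.C ((r : ℝ) - i * lam)) =
      ∑ k ∈ range (n + 1), S n k • descPochhammer ℝ k := by
    refine Polynomial.funext fun x => ?_
    rw [← dfall_eq_eval, hS, Polynomial.eval_finsetSum]
    simp only [ffall_eq_eval, Polynomial.eval_smul, smul_eq_mul]
  rw [Nat.add_sub_cancel_left, ← ((semiconjBy_raising_pow hcomm r).algFall lam n).eq,
    algFall_add_natCast, hpoly, map_sum, mul_sum, sum_mul, ← Ico_add_one_right_eq_Icc,
    sum_Ico_eq_sum_range, add_assoc, Nat.add_sub_cancel_left]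
  refine sum_congr rfl fun k _ => ?_
  rw [map_smul, aeval_descPochhammer_number hcomm, mul_smul_comm, smul_mul_assoc, Nat.cast_add,
    add_sub_cancel_left, pow_add ad, add_comm r k, pow_add a]
  simp only [mul_assoc]
end

section
/- Let λ ∈ ℝ and let r ≥ 0 be an integer. For all integers n, k with n + 1 ≥ k ≥ 0, the degenerate r-Stirling numbers of the second kind satisfy the recurrence {n+r+1 \brace k+r}_{r,λ} = {n+r \brace (k−1)+r}_{r,λ} + (k + r − nλ) · {n+r \brace k+r}_{r,λ}, where the terms with index k−1 = −1 or k = n+1 in the second summand are interpreted as 0 by the stated convention. -/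
open Finset

theorem ffall_succ (x : ℝ) (n : ℕ) : ffall x (n + 1) = ffall x n * (x - n) :=
  Finset.prod_range_succ _ n

theorem dfall_succ (lam x : ℝ) (n : ℕ) :
    dfall lam x (n + 1) = dfall lam x n * (x - n * lam) :=
  Finset.prod_range_succ _ n

theorem ffall_natCast_of_lt {m j : ℕ} (h : m < j) : ffall m j = 0 :=
  Finset.prod_eq_zero (Finset.mem_range.2 h) (sub_self _)

theorem ffall_natCast_self_ne_zero (m : ℕ) : ffall m m ≠ 0 :=
  Finset.prod_ne_zero_iff.2 fun i hi =>
    sub_ne_zero.2 (by exact_mod_cast (Finset.mem_range.1 hi).ne')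

/-- The falling factorials are linearly independent as functions on `ℝ`. -/
theorem eq_zero_of_sum_mul_ffall_eq_zero {N : ℕ} {c : ℕ → ℝ}
    (h : ∀ x : ℝ, ∑ j ∈ Finset.range N, c j * ffall x j = 0) {m : ℕ} (hm : m < N) :
    c m = 0 := by
  induction m using Nat.strong_induction_on with
  | _ m ih =>
    have hsum := h m
    rw [Finset.sum_eq_single_of_mem m (Finset.mem_range.2 hm)] at hsum
    · exact (mul_eq_zero.1 hsum).resolve_right (ffall_natCast_self_ne_zero m)
    · intro j hj hne
      rcases lt_or_gt_of_ne hne with hlt | hgt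
      · rw [ih j hlt (Finset.mem_range.1 hj), zero_mul]
      · rw [ffall_natCast_of_lt hgt, mul_zero]

/-- the recurrence
`{n+r+1 \brace k+r}_{r,λ} = {n+r \brace (k−1)+r}_{r,λ} + (k+r−nλ){n+r \brace k+r}_{r,λ}`
for `0 ≤ k ≤ n+1`. -/
theorem statement4 (lam : ℝ) (r : ℕ) (S : ℕ → ℤ → ℝ)
    (hS : ∀ (n : ℕ) (x : ℝ),
      dfall lam (x + r) n = ∑ k ∈ Finset.range (n + 1), S n k * ffall x k)
    (hS0 : ∀ (n : ℕ) (k : ℤ), k < 0 ∨ (n : ℤ) < k → S n k = 0)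
    (n k : ℕ) (hk : k ≤ n + 1) :
    S (n + 1) k = S n ((k : ℤ) - 1) + ((k : ℝ) + r - n * lam) * S n k := by
  have key : ∀ x : ℝ, ∑ j ∈ Finset.range (n + 2),
      (S (n + 1) j - (S n ((j : ℤ) - 1) + ((j : ℝ) + r - n * lam) * S n j)) * ffall x j = 0 := by
    intro x
    have shifted : ∑ j ∈ Finset.range (n + 2), S n ((j : ℤ) - 1) * ffall x j =
        ∑ j ∈ Finset.range (n + 1), S n j * ffall x (j + 1) := by
      rw [Finset.sum_range_succ', hS0 n _ (Or.inl (by simp)), zero_mul, add_zero]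
      simp
    have diagonal : ∑ j ∈ Finset.range (n + 2),
        ((j : ℝ) + r - n * lam) * S n j * ffall x j =
        ∑ j ∈ Finset.range (n + 1), ((j : ℝ) + r - n * lam) * S n j * ffall x j := by
      rw [Finset.sum_range_succ, hS0 n _ (Or.inr (by simp)), mul_zero, zero_mul, add_zero]
    simp only [sub_mul _ _ (ffall _ _), add_mul (S _ _) _ (ffall _ _),
      Finset.sum_sub_distrib, Finset.sum_add_distrib]
    rw [← hS (n + 1) x, shifted, diagonal, dfall_succ, hS n x, Finset.sum_mul,
      ← Finset.sum_add_distrib, sub_eq_zero]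
    refine Finset.sum_congr rfl fun j _ => ?_
    rw [ffall_succ]
    ring
  exact sub_eq_zero.1 (eq_zero_of_sum_mul_ffall_eq_zero key (Nat.lt_succ_of_le hk))
end

section
/- Let A be an associative unital ℝ-algebra containing elements a and a⁺ with a·a⁺ − a⁺·a = 1, let λ ∈ ℝ, and let k, r be integers with k ≥ r ≥ 0. Then (a⁺)^{k−r} a^{k−r} = Σ_{m=r}^{k} (−1)^{k−m} {(k−r)+r \brack (m−r)+r}_{r,λ} · (a⁺a + r)_{m−r,λ} in A. -/
open Finset

open Polynomial in
/-- The degenerate falling factorial of `u` is the polynomial `∏ (X - iλ)` evaluated at `u`. -/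
theorem algFall_eq_aeval {A : Type*} [Ring A] [Algebra ℝ A] (lam : ℝ) (u : A) (m : ℕ) :
    algFall lam u m = aeval u (∏ i ∈ Finset.range m, (X - C ((i : ℝ) * lam))) := by
  induction m with
  | zero => simp [algFall]
  | succ m ih =>
    have hX : aeval u (X - C ((m : ℝ) * lam)) = u - ((m : ℝ) * lam) • (1 : A) := by
      rw [map_sub, aeval_X, aeval_C, Algebra.algebraMap_eq_smul_one]
    rw [Finset.prod_range_succ, map_mul, ← ih, hX]
    simp [algFall, List.range_succ]

/-- Commuting a power of the annihilation operator past the number operator. -/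
theorem pow_mul_number {A : Type*} [Ring A] {a ad : A} (hcomm : a * ad - ad * a = 1) (n : ℕ) :
    a ^ n * (ad * a) = ad * a ^ (n + 1) + n * a ^ n := by
  have h : a * ad = ad * a + 1 := by rw [← hcomm]; abel
  induction n with
  | zero => simp
  | succ n ih =>
    calc a ^ (n + 1) * (ad * a) = a * (a ^ n * (ad * a)) := by rw [pow_succ', mul_assoc]
      _ = (a * ad) * a ^ (n + 1) + n * (a * a ^ n) := by
        rw [ih, mul_add, ← mul_assoc, ← mul_assoc, ← mul_assoc, (Nat.cast_commute n a).eq]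
      _ = ad * a ^ (n + 1 + 1) + ((n + 1 : ℕ) : A) * a ^ (n + 1) := by
        rw [h, ← pow_succ', pow_succ' a (n + 1)]
        push_cast
        noncomm_ring

open Polynomial in
/-- Normal ordering: `(a⁺)ⁿ aⁿ` is a falling factorial of the number operator. -/
theorem pow_mul_pow_eq_aeval {A : Type*} [Ring A] [Algebra ℝ A] {a ad : A}
    (hcomm : a * ad - ad * a = 1) (r n : ℕ) :
    ad ^ n * a ^ n
      = aeval (ad * a + (r : A)) (∏ i ∈ Finset.range n, (X - C ((r : ℝ) + i))) := by
  induction n with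
  | zero => simp
  | succ n ih =>
    rw [Finset.prod_range_succ, map_mul, ← ih]
    have hX : aeval (ad * a + (r : A)) (X - C ((r : ℝ) + n)) = ad * a - n := by
      simp only [map_sub, aeval_X, map_add, map_natCast]
      abel
    rw [hX, mul_sub, mul_assoc (ad ^ n) (a ^ n) (ad * a), pow_mul_number hcomm, mul_add,
      mul_assoc (ad ^ n) (a ^ n) (n : A), (Nat.cast_commute n (a ^ n)).eq, add_sub_cancel_right,
      ← mul_assoc, ← pow_succ]

/-- Reflection `⟨-x⟩_{n,λ} = (-1)ⁿ (x)_{n,λ}`. -/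
theorem drise_neg (lam x : ℝ) (n : ℕ) : drise lam (-x) n = (-1) ^ n * dfall lam x n := by
  induction n with
  | zero => simp [drise, dfall]
  | succ n ih =>
    unfold drise dfall at *
    rw [Finset.prod_range_succ, Finset.prod_range_succ, ih]
    ring

/-- for `k ≥ r ≥ 0`,
`(a⁺)^{k−r} a^{k−r} = Σ_{m=r}^{k} (−1)^{k−m} {(k−r)+r \brack (m−r)+r}_{r,λ} (a⁺a+r)_{m−r,λ}`. -/
theorem statement7 {A : Type*} [Ring A] [Algebra ℝ A] (a ad : A)
    (hcomm : a * ad - ad * a = 1) (lam : ℝ) (k r : ℕ) (hrk : r ≤ k) (T : ℕ → ℤ → ℝ)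
    (hT : ∀ (n : ℕ) (x : ℝ),
      rise (x + r) n = ∑ j ∈ Finset.range (n + 1), T n j * drise lam x j)
    (hT0 : ∀ (n : ℕ) (j : ℤ), j < 0 ∨ (n : ℤ) < j → T n j = 0) :
    ad ^ (k - r) * a ^ (k - r)
      = ∑ m ∈ Finset.Icc r k,
          ((-1 : ℝ) ^ (k - m) * T (k - r) ((m : ℤ) - r)) • algFall lam (ad * a + (r : A)) (m - r) := by
  obtain ⟨n, rfl⟩ := Nat.exists_eq_add_of_le hrk
  have hpoly : (∏ i ∈ Finset.range n, (Polynomial.X - Polynomial.C ((r : ℝ) + i)))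
      = ∑ j ∈ Finset.range (n + 1), ((-1 : ℝ) ^ (n - j) * T n j) •
          ∏ i ∈ Finset.range j, (Polynomial.X - Polynomial.C ((i : ℝ) * lam)) := by
    refine Polynomial.funext fun y => ?_
    simp only [Polynomial.eval_prod, Polynomial.eval_finsetSum, Polynomial.eval_smul,
      Polynomial.eval_sub, Polynomial.eval_X, Polynomial.eval_C, smul_eq_mul]
    have hrise : rise (-y + r) n = (-1) ^ n * ∏ i ∈ Finset.range n, (y - ((r : ℝ) + i)) := by
      have h := drise_neg 1 (y - r) n
      simp only [drise, dfall, mul_one] at h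
      rw [rise, show -y + (r : ℝ) = -(y - r) by ring, h]
      simp only [sub_sub]
    have hsq : ((-1 : ℝ) ^ n) * (-1) ^ n = 1 := by rw [← mul_pow]; simp
    have hprod : ∏ i ∈ Finset.range n, (y - ((r : ℝ) + i)) = (-1) ^ n * rise (-y + r) n := by
      rw [hrise, ← mul_assoc, hsq, one_mul]
    rw [hprod, hT, Finset.mul_sum]
    refine Finset.sum_congr rfl fun j hj => ?_
    obtain ⟨d, rfl⟩ := Nat.exists_eq_add_of_le (Nat.lt_succ_iff.mp (Finset.mem_range.mp hj))
    have hsq' : ((-1 : ℝ) ^ j) * (-1) ^ j = 1 := by rw [← mul_pow]; simp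
    rw [drise_neg, dfall, Nat.add_sub_cancel_left, pow_add]
    linear_combination ((-1 : ℝ) ^ d * T (j + d) j *
      ∏ i ∈ Finset.range j, (y - (i : ℝ) * lam)) * hsq'
  rw [Nat.add_sub_cancel_left, pow_mul_pow_eq_aeval hcomm r n, hpoly, map_sum,
    ← Finset.Ico_add_one_right_eq_Icc, Finset.sum_Ico_eq_sum_range,
    show r + n + 1 - r = n + 1 by omega]
  refine Finset.sum_congr rfl fun j _ => ?_
  rw [map_smul, algFall_eq_aeval, Nat.add_sub_cancel_left, Nat.add_sub_add_left,
    show ((r + j : ℕ) : ℤ) - r = j by push_cast; ring]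
end
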